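/- Let k[α_0,…,α_N] be the standard graded polynomial ring, I_X ⊆ k[α_0,…,α_N] a saturated homogeneous ideal generated in degrees ≤ d (the ideal of a projective scheme X), S = k[α_0,…,α_N]/I_X, and I ⊆ S a homogeneous ideal generated in degrees ≤ d. Suppose d ≥ r and dim_k (S/I)_d = dim_k (S/I)_{d+1} = r. Then dim_k (S/I)_{d'} = r for all d' ≥ d; i.e., the subscheme Z(I) ⊆ X cut out by I is a finite scheme of degree r, and I agrees with the saturated ideal of Z(I) in all degrees ≥ d. -/

import Mathlib

open MvPolynomial

/-- The value at `n` of the Hilbert function of `k[α₀,…,α_N]/J`, i.e. the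
dimension of the degree-`n` graded piece of the quotient. -/
noncomputable def hilb (k : Type*) [Field k] (N : ℕ)
    (J : Ideal (MvPolynomial (Fin (N + 1)) k)) (n : ℕ) : ℕ :=
  Module.finrank k
    (↥(homogeneousSubmodule (Fin (N + 1)) k n) ⧸
      Submodule.comap (homogeneousSubmodule (Fin (N + 1)) k n).subtype
        (J.restrictScalars k))

/-- The irrelevant maximal ideal `(α₀, …, α_N)`. -/
noncomputable def irrel (k : Type*) [Field k] (N : ℕ) :
    Ideal (MvPolynomial (Fin (N + 1)) k) :=
  Ideal.span (Set.range (X : Fin (N + 1) → MvPolynomial (Fin (N + 1)) k))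

section helpers

open Filter

theorem aux_mem_of_eventually {k : Type*} [Field k] [Infinite k] {N : ℕ} {Q : Type*}
    [AddCommGroup Q] [Module k Q] (P : Submodule k Q) (v : Fin (N + 1) → Q)
    (h : ∀ᶠ s : k in cofinite, ∑ i : Fin (N + 1), s ^ (i : ℕ) • v i ∈ P) (i : Fin (N + 1)) : v i ∈ P := by
  classical
  by_contra hi
  obtain ⟨f, hf, hP⟩ := Submodule.exists_le_ker_of_notMem hi
  set p : Polynomial k := ∑ j : Fin (N + 1), Polynomial.monomial (j : ℕ) (f (v j)) with hp
  have hpc : p.coeff i = f (v i) := by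
    simp only [hp, Polynomial.finsetSum_coeff, Polynomial.coeff_monomial]
    rw [Finset.sum_eq_single i]
    · simp
    · intro b _ hb
      rw [if_neg]
      intro h; exact hb (Fin.ext h)
    · simp
  have hp0 : p ≠ 0 := by
    intro h0; rw [h0] at hpc; simp at hpc; exact hf hpc.symm
  have hfin : ∀ᶠ s : k in cofinite, ¬ p.IsRoot s := by
    have := Polynomial.finite_setOfPred_isRoot hp0
    simpa [Filter.eventually_cofinite] using this
  obtain ⟨s, hs1, hs2⟩ := (h.and hfin).exists
  apply hs2
  have := hP hs1
  rw [LinearMap.mem_ker] at this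
  rw [Polynomial.IsRoot, hp, Polynomial.eval_finsetSum]
  simp only [Polynomial.eval_monomial]
  rw [map_sum] at this
  rw [← this]
  refine Finset.sum_congr rfl fun j _ => ?_
  simp [mul_comm]

theorem aux_open {k : Type*} [Field k] {N m : ℕ} {Q : Type*}
    [AddCommGroup Q] [Module k Q] (v : Fin m → Fin (N + 1) → Q) (t : k)
    (h : LinearIndependent k (fun j => ∑ i : Fin (N + 1), t ^ (i : ℕ) • v j i)) :
    ∀ᶠ s : k in cofinite, LinearIndependent k (fun j => ∑ i : Fin (N + 1), s ^ (i : ℕ) • v j i) := by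
  classical
  have hinj : LinearMap.ker (Fintype.linearCombination k (fun j => ∑ i : Fin (N + 1), t ^ (i : ℕ) • v j i)) = ⊥ :=
    LinearMap.ker_eq_bot.2 (linearIndependent_iff_injective_fintypeLinearCombination.1 h)
  obtain ⟨L, hL⟩ := LinearMap.exists_leftInverse_of_injective _ hinj
  let M : Matrix (Fin m) (Fin m) (Polynomial k) := Matrix.of fun j l =>
    ∑ i : Fin (N + 1), Polynomial.monomial (i : ℕ) (L (v j i) l)
  have hM : ∀ s : k, (Polynomial.evalRingHom s).mapMatrix M =
      Matrix.of fun j => L (∑ i : Fin (N + 1), s ^ (i : ℕ) • v j i) := by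
    intro s
    ext j l
    simp [M, Polynomial.eval_finsetSum, mul_comm]
  have hdet : ∀ s : k, M.det.eval s = (Matrix.of fun j => L (∑ i : Fin (N + 1), s ^ (i : ℕ) • v j i)).det := by
    intro s
    rw [← hM, ← RingHom.map_det]; rfl
  have h0 : M.det ≠ 0 := by
    intro h0
    have := hdet t
    rw [h0] at this
    have h1 : (Matrix.of fun j => L (∑ i : Fin (N + 1), t ^ (i : ℕ) • v j i)) = 1 := by
      ext j l
      have := LinearMap.congr_fun hL (Pi.single j 1)
      simp only [LinearMap.comp_apply, Fintype.linearCombination_apply_single, one_smul,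
        LinearMap.id_apply] at this
      simp only [Matrix.of_apply, this]
      simp [Matrix.one_apply, Pi.single_apply, eq_comm]
    rw [h1] at this
    simp at this
  have hfin : ∀ᶠ s : k in cofinite, ¬ M.det.IsRoot s := by
    have := Polynomial.finite_setOfPred_isRoot h0
    simpa [Filter.eventually_cofinite] using this
  filter_upwards [hfin] with s hs
  rw [Polynomial.IsRoot, hdet] at hs
  exact LinearIndependent.of_comp L (Matrix.linearIndependent_rows_of_det_ne_zero hs)

/-- Induction principle for homogeneous polynomials of positive degree. -/
theorem aux_homog_succ {k : Type*} [Field k] {N : ℕ} (n : ℕ)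
    (P : Submodule k (MvPolynomial (Fin (N + 1)) k))
    (h : ∀ i, ∀ g ∈ homogeneousSubmodule (Fin (N + 1)) k n, X i * g ∈ P) :
    homogeneousSubmodule (Fin (N + 1)) k (n + 1) ≤ P := by
  classical
  intro f hf
  rw [mem_homogeneousSubmodule] at hf
  rw [f.as_sum]
  refine Submodule.sum_mem _ fun m hm => ?_
  have hdeg : m.degree = n + 1 := by
    have := hf (mem_support_iff.1 hm)
    rw [Finsupp.degree_eq_weight_one]; exact this
  have hm0 : m ≠ 0 := by
    rintro rfl; simp at hdeg
  obtain ⟨i, hi⟩ := Finsupp.ne_iff.1 hm0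
  have hle : Finsupp.single i 1 ≤ m := by
    rw [Finsupp.single_le_iff]; exact Nat.one_le_iff_ne_zero.2 hi
  have key : monomial m (coeff m f) = X i * monomial (m - Finsupp.single i 1) (coeff m f) := by
    rw [X, monomial_mul, one_mul, add_tsub_cancel_of_le hle]
  rw [key]
  apply h
  rw [mem_homogeneousSubmodule]
  apply isHomogeneous_monomial
  have : (m - Finsupp.single i 1 + Finsupp.single i 1).degree = n + 1 := by
    rw [tsub_add_cancel_of_le hle, hdeg]
  rw [map_add, Finsupp.degree_single] at this
  omega

instance aux_fd {k : Type*} [Field k] {N : ℕ} (n : ℕ) :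
    FiniteDimensional k (homogeneousSubmodule (Fin (N + 1)) k n) := by
  classical
  have hfin : {m : Fin (N + 1) →₀ ℕ | m.degree = n}.Finite := by
    have := Finsupp.finite_of_degree_le (σ := Fin (N+1)) n
    exact this.subset fun m hm => le_of_eq hm
  rw [homogeneousSubmodule_eq_finsupp_supported]
  rw [AddMonoidAlgebra.supported_eq_span_single]
  exact FiniteDimensional.span_of_finite k (hfin.image _)

/-- The moment curve of linear forms. -/
noncomputable def lin {k : Type*} [Field k] (N : ℕ) (s : k) : MvPolynomial (Fin (N + 1)) k :=
  ∑ i : Fin (N + 1), s ^ (i : ℕ) • X i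

theorem lin_homog {k : Type*} [Field k] (N : ℕ) (s : k) : (lin N s).IsHomogeneous 1 := by
  rw [← mem_homogeneousSubmodule]
  refine Submodule.sum_mem _ fun i _ => Submodule.smul_mem _ _ ?_
  exact isHomogeneous_X _ _

theorem aux_mulLeft_le {k : Type*} [Field k] {N : ℕ} (l : MvPolynomial (Fin (N + 1)) k)
    (hl : l.IsHomogeneous 1) (n : ℕ) :
    (homogeneousSubmodule (Fin (N + 1)) k n).map (LinearMap.mulLeft k l) ≤
      homogeneousSubmodule (Fin (N + 1)) k (n + 1) := by
  rintro _ ⟨f, hf, rfl⟩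
  have := hl.mul hf
  rw [mem_homogeneousSubmodule, add_comm n 1]
  exact this

theorem green_step {k : Type*} [Field k] [Infinite k] {N : ℕ} {Q : Type*}
    [AddCommGroup Q] [Module k Q] (π : MvPolynomial (Fin (N + 1)) k →ₗ[k] Q) (n : ℕ)
    (hdim : Module.finrank k ((homogeneousSubmodule (Fin (N + 1)) k (n + 1)).map π) ≤ n + 1)
    (ih : ∀ t : k, Module.finrank k ((homogeneousSubmodule (Fin (N + 1)) k n).map
        (π ∘ₗ LinearMap.mulLeft k (lin N t))) ≤ n → ∀ᶠ s : k in cofinite,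
        (homogeneousSubmodule (Fin (N + 1)) k n).map (π ∘ₗ LinearMap.mulLeft k (lin N t)) ≤
        (homogeneousSubmodule (Fin (N + 1)) k n).map (π ∘ₗ LinearMap.mulLeft k (lin N s))) :
    ∀ᶠ s : k in cofinite, (homogeneousSubmodule (Fin (N + 1)) k (n + 1)).map π ≤
        (homogeneousSubmodule (Fin (N + 1)) k n).map (π ∘ₗ LinearMap.mulLeft k (lin N s)) := by
  classical
  set P := (homogeneousSubmodule (Fin (N + 1)) k (n + 1)).map π with hP
  set Qs : k → Submodule k Q := fun s =>
    (homogeneousSubmodule (Fin (N + 1)) k n).map (π ∘ₗ LinearMap.mulLeft k (lin N s)) with hQs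
  have hfP : FiniteDimensional k P := by rw [hP]; infer_instance
  have hle : ∀ s, Qs s ≤ P := by
    intro s
    simp only [hQs, hP]
    rw [Submodule.map_comp]
    exact Submodule.map_mono (aux_mulLeft_le _ (lin_homog N s) n)
  have hexp : ∀ (s : k) (g : MvPolynomial (Fin (N + 1)) k),
      π (lin N s * g) = ∑ i : Fin (N + 1), s ^ (i : ℕ) • π (X i * g) := by
    intro s g
    simp [lin, Finset.sum_mul, map_sum]
  change ∀ᶠ s : k in cofinite, P ≤ Qs s
  by_cases hex : ∃ t, Qs t = P
  · obtain ⟨t, ht⟩ := hex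
    let b := Module.finBasis k P
    have hb : ∀ j, ∃ g ∈ homogeneousSubmodule (Fin (N + 1)) k n, π (lin N t * g) = b j := by
      intro j
      have : (b j : Q) ∈ Qs t := by rw [ht]; exact (b j).2
      obtain ⟨g, hg, hg2⟩ := this
      exact ⟨g, hg, hg2⟩
    choose g hg hgb using hb
    have hli : LinearIndependent k (fun j => ∑ i : Fin (N + 1), t ^ (i : ℕ) • π (X i * g j)) := by
      have := b.linearIndependent.map' P.subtype (by simp)
      have he : (fun j => ∑ i : Fin (N + 1), t ^ (i : ℕ) • π (X i * g j)) = P.subtype ∘ b := by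
        ext j
        rw [← hexp, hgb]; rfl
      rw [he]; exact this
    filter_upwards [aux_open _ t hli] with s hs
    have hsub : Submodule.span k (Set.range
        (fun j => ∑ i : Fin (N + 1), s ^ (i : ℕ) • π (X i * g j))) ≤ Qs s := by
      rw [Submodule.span_le]
      rintro _ ⟨j, rfl⟩
      simp only [← hexp]
      exact ⟨g j, hg j, rfl⟩
    refine (Submodule.eq_of_le_of_finrank_le (hle s) ?_).ge
    have hfQ : FiniteDimensional k (Qs s) :=
        inferInstanceAs (FiniteDimensional k (Submodule.map _ _))
    calc Module.finrank k P = Module.finrank k (Submodule.span k (Set.range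
        (fun j => ∑ i : Fin (N + 1), s ^ (i : ℕ) • π (X i * g j)))) := by
          rw [finrank_span_eq_card hs]; simp
      _ ≤ _ := Submodule.finrank_mono hsub
  · push Not at hex
    exfalso
    have hlt : ∀ t, Module.finrank k (Qs t) < Module.finrank k P := fun t =>
      Submodule.finrank_lt_finrank_of_lt (lt_of_le_of_ne (hle t) (hex t))
    obtain ⟨t, ht⟩ : ∃ t, ∀ s, Module.finrank k (Qs s) ≤ Module.finrank k (Qs t) := by
      have hfin : (Set.range fun s => Module.finrank k (Qs s)).Finite :=
        (Set.finite_Iio (Module.finrank k P)).subset (by rintro _ ⟨s, rfl⟩; exact hlt s)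
      obtain ⟨_, ⟨t, rfl⟩, ht⟩ := Set.exists_max_image _ id hfin ⟨_, 0, rfl⟩
      exact ⟨t, fun s => ht _ ⟨s, rfl⟩⟩
    have h3 : Module.finrank k (Qs t) ≤ n := by
      have := hlt t
      omega
    have h1 := ih t h3
    have h2 : ∀ᶠ s : k in cofinite, Qs s ≤ Qs t := by
      filter_upwards [h1] with s hs
      have hfQ : FiniteDimensional k (Qs s) :=
        inferInstanceAs (FiniteDimensional k (Submodule.map _ _))
      exact (Submodule.eq_of_le_of_finrank_le hs (ht s)).ge
    apply hex t
    refine le_antisymm (hle t) ?_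
    rw [hP, Submodule.map_le_iff_le_comap]
    apply aux_homog_succ
    intro i g hg
    rw [Submodule.mem_comap]
    refine aux_mem_of_eventually (Qs t) (fun i => π (X i * g)) ?_ i
    filter_upwards [h2] with s hs
    rw [← hexp]
    exact hs ⟨g, hg, rfl⟩

/-- Green's hyperplane restriction theorem in the range `codim ≤ degree`. -/
theorem green {k : Type*} [Field k] [Infinite k] {N : ℕ} {Q : Type*}
    [AddCommGroup Q] [Module k Q] (n : ℕ) : ∀ (π : MvPolynomial (Fin (N + 1)) k →ₗ[k] Q)
    (_ : Module.finrank k ((homogeneousSubmodule (Fin (N + 1)) k (n + 1)).map π) ≤ n + 1),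
    ∀ᶠ s : k in cofinite, (homogeneousSubmodule (Fin (N + 1)) k (n + 1)).map π ≤
        (homogeneousSubmodule (Fin (N + 1)) k n).map (π ∘ₗ LinearMap.mulLeft k (lin N s)) := by
  induction n with
  | zero =>
    intro π h
    refine green_step π 0 h fun t ht => Eventually.of_forall fun s => ?_
    have := Submodule.finrank_eq_zero.1 (Nat.le_zero.1 ht)
    rw [this]; exact bot_le
  | succ n ih =>
    intro π h
    refine green_step π (n + 1) h fun t ht => ?_
    filter_upwards [ih _ ht] with s hs
    refine hs.trans ?_
    rintro _ ⟨g, hg, rfl⟩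
    refine ⟨lin N t * g, aux_mulLeft_le _ (lin_homog N t) n ⟨g, hg, rfl⟩, ?_⟩
    simp only [LinearMap.comp_apply, LinearMap.mulLeft_apply]
    congr 1; ring

/-- The algebra homomorphism to endomorphisms given by commuting operators. -/
theorem aux_exists_hom {k : Type*} [Field k] {N : ℕ} {V : Type*} [AddCommGroup V] [Module k V]
    (T : Fin (N + 1) → Module.End k V) (hT : ∀ i j, T i * T j = T j * T i) :
    ∃ φ : MvPolynomial (Fin (N + 1)) k →ₐ[k] Module.End k V, ∀ i, φ (X i) = T i := by
  have hc := Algebra.isMulCommutative_adjoin k (s := Set.range T) (by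
    rintro _ ⟨i, rfl⟩ _ ⟨j, rfl⟩; exact hT i j)
  open scoped IsMulCommutative in
  refine ⟨(Algebra.adjoin k (Set.range T)).val.comp
    (MvPolynomial.aeval fun i => ⟨T i, Algebra.subset_adjoin ⟨i, rfl⟩⟩), fun i => ?_⟩
  simp

/-- The quotient map as a linear map. -/
noncomputable abbrev qm {k : Type*} [Field k] {N : ℕ}
    (J : Ideal (MvPolynomial (Fin (N + 1)) k)) :
    MvPolynomial (Fin (N + 1)) k →ₗ[k] (MvPolynomial (Fin (N + 1)) k ⧸ J) :=
  (Ideal.Quotient.mkₐ k J).toLinearMap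

/-- The graded piece of the quotient. -/
noncomputable abbrev gp {k : Type*} [Field k] {N : ℕ}
    (J : Ideal (MvPolynomial (Fin (N + 1)) k)) (n : ℕ) :
    Submodule k (MvPolynomial (Fin (N + 1)) k ⧸ J) :=
  (homogeneousSubmodule (Fin (N + 1)) k n).map (qm J)

theorem qm_eq_zero {k : Type*} [Field k] {N : ℕ}
    (J : Ideal (MvPolynomial (Fin (N + 1)) k)) (f) : qm J f = 0 ↔ f ∈ J :=
  Ideal.Quotient.eq_zero_iff_mem

theorem qm_mul {k : Type*} [Field k] {N : ℕ}
    (J : Ideal (MvPolynomial (Fin (N + 1)) k)) (f g) : qm J (f * g) = qm J f * qm J g :=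
  map_mul (Ideal.Quotient.mkₐ k J) f g

theorem hilb_eq {k : Type*} [Field k] {N : ℕ}
    (J : Ideal (MvPolynomial (Fin (N + 1)) k)) (n : ℕ) :
    hilb k N J n = Module.finrank k (gp J n) := by
  unfold hilb
  have h1 : Submodule.comap (homogeneousSubmodule (Fin (N + 1)) k n).subtype
        (J.restrictScalars k) =
      LinearMap.ker (qm J ∘ₗ (homogeneousSubmodule (Fin (N + 1)) k n).subtype) := by
    ext f
    simp only [Submodule.mem_comap, LinearMap.mem_ker, LinearMap.comp_apply, qm_eq_zero]
    rfl
  have h2 : gp J n =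
      LinearMap.range (qm J ∘ₗ (homogeneousSubmodule (Fin (N + 1)) k n).subtype) := by
    rw [LinearMap.range_comp, Submodule.range_subtype]
  rw [h1, h2]
  exact (LinearMap.quotKerEquivRange _).finrank_eq

theorem gp_finrank_succ_le {k : Type*} [Field k] {N d : ℕ}
    (J : Ideal (MvPolynomial (Fin (N + 1)) k)) (l : MvPolynomial (Fin (N + 1)) k)
    (hs : gp J (d + 1) ≤
      (homogeneousSubmodule (Fin (N + 1)) k d).map (qm J ∘ₗ LinearMap.mulLeft k l)) (n : ℕ)
    (hn : d ≤ n) : gp J (n + 1) ≤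
      (homogeneousSubmodule (Fin (N + 1)) k n).map (qm J ∘ₗ LinearMap.mulLeft k l) := by
  induction n, hn using Nat.le_induction with
  | base => exact hs
  | succ n hn ih =>
    rw [Submodule.map_le_iff_le_comap]
    apply aux_homog_succ
    intro i g hg
    obtain ⟨h, hh, hhg⟩ := ih ⟨g, hg, rfl⟩
    refine ⟨X i * h, aux_mulLeft_le _ (isHomogeneous_X _ _) _ ⟨h, hh, rfl⟩, ?_⟩
    simp only [LinearMap.comp_apply, LinearMap.mulLeft_apply, qm_mul] at hhg ⊢
    rw [← hhg]; ring

theorem core {k : Type*} [Field k] {N r d : ℕ}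
    (J : Ideal (MvPolynomial (Fin (N + 1)) k)) (c : Fin (N + 1) → k)
    (l : MvPolynomial (Fin (N + 1)) k) (hlc : l = ∑ i, c i • X i)
    (hl : l.IsHomogeneous 1)
    (hs : gp J (d + 1) ≤
      (homogeneousSubmodule (Fin (N + 1)) k d).map (qm J ∘ₗ LinearMap.mulLeft k l))
    (hgen : J = Ideal.span {f | f ∈ J ∧ ∃ n ≤ d + 1, MvPolynomial.IsHomogeneous f n})
    (h1 : Module.finrank k (gp J (d + 1)) = r) (h2 : Module.finrank k (gp J (d + 2)) = r) :
    (∀ n, d + 1 ≤ n → Module.finrank k (gp J n) = r) ∧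
    (∀ f : MvPolynomial (Fin (N + 1)) k, ∀ n : ℕ, d + 1 ≤ n →
      MvPolynomial.IsHomogeneous f n → (∃ m : ℕ, f * l ^ m ∈ J) → f ∈ J) := by
  classical
  -- multiplication by `l` from degree `d+1` to degree `d+2`
  have hmem : ∀ (p : MvPolynomial (Fin (N + 1)) k), p.IsHomogeneous 1 → ∀ n, ∀ v ∈ gp J n,
      qm J p * v ∈ gp J (n + 1) := by
    rintro p hp n _ ⟨f, hf, rfl⟩
    exact ⟨p * f, aux_mulLeft_le _ hp _ ⟨f, hf, rfl⟩, qm_mul J p f⟩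
  let mul : ∀ (p : MvPolynomial (Fin (N + 1)) k), p.IsHomogeneous 1 →
      (gp J (d + 1) →ₗ[k] gp J (d + 2)) := fun p hp =>
    (LinearMap.mulLeft k (qm J p)).restrict (hmem p hp (d + 1))
  have hmul : ∀ p hp v, (mul p hp v : _ ⧸ J) = qm J p * v := fun p hp v => rfl
  have hsurj : Function.Surjective (mul l hl) := by
    rintro ⟨v, hv⟩
    obtain ⟨g, hg, rfl⟩ := gp_finrank_succ_le J l hs (d + 1) (by omega) hv
    refine ⟨⟨qm J g, g, hg, rfl⟩, Subtype.ext ?_⟩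
    exact (qm_mul J l g).symm
  have hinj : Function.Injective (mul l hl) :=
    (LinearMap.injective_iff_surjective_of_finrank_eq_finrank (h1.trans h2.symm)).2 hsurj
  let e : gp J (d + 1) ≃ₗ[k] gp J (d + 2) := LinearEquiv.ofBijective _ ⟨hinj, hsurj⟩
  let T : Fin (N + 1) → Module.End k (gp J (d + 1)) := fun i =>
    e.symm.toLinearMap ∘ₗ mul (X i) (isHomogeneous_X _ _)
  have hT : ∀ i v, qm J l * (T i v : _ ⧸ J) = qm J (X i) * v := by
    intro i v
    rw [← hmul l hl]
    have : mul l hl (T i v) = mul (X i) (isHomogeneous_X _ _) v :=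
      LinearEquiv.apply_symm_apply e _
    rw [this]; rfl
  have hcancel : ∀ v w : gp J (d + 1), qm J l * (v : _ ⧸ J) = qm J l * w → v = w := by
    intro v w h
    apply hinj
    exact Subtype.ext h
  -- key formula
  have hTkey : ∀ i (b : MvPolynomial (Fin (N + 1)) k), b.IsHomogeneous d →
      ∀ v : gp J (d + 1), (v : _ ⧸ J) = qm J (l * b) → (T i v : _ ⧸ J) = qm J (X i * b) := by
    intro i b hb v hv
    have hx : qm J (X i * b) ∈ gp J (d + 1) :=
      ⟨X i * b, aux_mulLeft_le _ (isHomogeneous_X _ _) _ ⟨b, hb, rfl⟩, rfl⟩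
    have : T i v = ⟨_, hx⟩ := by
      apply hcancel
      rw [hT, hv]
      simp only [qm_mul]; ring
    rw [this]
  have hrep : ∀ v : gp J (d + 1), ∃ b : MvPolynomial (Fin (N + 1)) k, b.IsHomogeneous d ∧
      (v : _ ⧸ J) = qm J (l * b) := by
    rintro ⟨v, hv⟩
    obtain ⟨b, hb, rfl⟩ := hs hv
    exact ⟨b, hb, rfl⟩
  have hcomm : ∀ i j, T i * T j = T j * T i := by
    intro i j
    ext v : 1
    obtain ⟨b, hb, hv⟩ := hrep v
    apply hcancel
    rw [Module.End.mul_apply, Module.End.mul_apply, hT, hT, hTkey j b hb v hv, hTkey i b hb v hv]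
    simp only [qm_mul]; ring
  obtain ⟨φ, hφ⟩ := aux_exists_hom T hcomm
  have hφl : φ l = 1 := by
    ext v : 1
    apply hcancel
    have : φ l v = ∑ i, c i • T i v := by
      rw [hlc, map_sum, LinearMap.sum_apply]
      simp [hφ]
    rw [this, Submodule.coe_sum, Finset.mul_sum]
    simp only [Submodule.coe_smul, mul_smul_comm, hT]
    rw [hlc, map_sum, Module.End.one_apply, Finset.sum_mul]
    simp only [map_smul, smul_mul_assoc]
  have hlpow : ∀ n, (l ^ n).IsHomogeneous n := by
    intro n
    simpa using hl.pow n
  let v0 : gp J (d + 1) := ⟨qm J (l ^ (d + 1)), l ^ (d + 1), hlpow _, rfl⟩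
  have hev : ∀ n m, n + m = d + 1 → ∀ f : MvPolynomial (Fin (N + 1)) k, f.IsHomogeneous n →
      (φ f v0 : _ ⧸ J) = qm J (l ^ m * f) := by
    intro n
    induction n with
    | zero =>
      intro m hm f hf
      obtain rfl : m = d + 1 := by omega
      rw [← totalDegree_zero_iff_isHomogeneous, totalDegree_eq_zero_iff_eq_C] at hf
      rw [hf, ← algebraMap_eq, AlgHom.commutes, Module.algebraMap_end_apply, mul_comm,
        ← Algebra.smul_def, map_smul]
      rfl
    | succ n ih =>
      intro m hm f hf
      let P : Submodule k (MvPolynomial (Fin (N + 1)) k) :=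
        LinearMap.eqLocus ((gp J (d + 1)).subtype ∘ₗ (LinearMap.applyₗ v0) ∘ₗ φ.toLinearMap)
          (qm J ∘ₗ LinearMap.mulLeft k (l ^ m))
      have : homogeneousSubmodule (Fin (N + 1)) k (n + 1) ≤ P := by
        apply aux_homog_succ
        intro i g hg
        rw [LinearMap.mem_eqLocus]
        change (φ (X i * g) v0 : _ ⧸ J) = qm J (l ^ m * (X i * g))
        rw [map_mul, hφ, Module.End.mul_apply]
        have hb : (l ^ m * g).IsHomogeneous d := by
          have := (hlpow m).mul hg
          rwa [show m + n = d by omega] at this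
        rw [hTkey i (l ^ m * g) hb]
        · congr 1; ring
        · rw [ih (m + 1) (by omega) g hg]
          congr 1; ring
      exact this hf
  have hker : ∀ f ∈ J, φ f v0 = 0 := by
    let K : Ideal (MvPolynomial (Fin (N + 1)) k) :=
      { carrier := {f | φ f v0 = 0}
        add_mem' := by
          intro a b ha hb
          simp only [Set.mem_ofPred_eq] at ha hb ⊢
          rw [map_add, LinearMap.add_apply, ha, hb, add_zero]
        zero_mem' := by simp
        smul_mem' := by
          intro a b hb
          simp only [Set.mem_ofPred_eq] at hb ⊢
          rw [smul_eq_mul, map_mul, Module.End.mul_apply, hb, map_zero] }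
    have hJK : J ≤ K := by
      rw [hgen, Ideal.span_le]
      rintro f ⟨hf, n, hn, hfn⟩
      change φ f v0 = 0
      apply Subtype.ext
      rw [hev n (d + 1 - n) (by omega) f hfn]
      exact (qm_eq_zero J _).2 (J.mul_mem_left _ hf)
    exact fun f hf => hJK hf
  let ev : (MvPolynomial (Fin (N + 1)) k ⧸ J) →ₗ[k] gp J (d + 1) :=
    Submodule.liftQ (J.restrictScalars k) ((LinearMap.applyₗ v0) ∘ₗ φ.toLinearMap)
      (fun f hf => hker f hf)
  have hev' : ∀ f, ev (qm J f) = φ f v0 := fun f => rfl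
  have hevs : ∀ n, d + 1 ≤ n → Function.Surjective (ev.domRestrict (gp J n)) := by
    intro n hn v
    obtain ⟨f, hf, hfv⟩ := v.2
    have hh : (l ^ (n - (d + 1)) * f).IsHomogeneous n := by
      have := (hlpow (n - (d + 1))).mul hf
      rwa [show n - (d + 1) + (d + 1) = n by omega] at this
    refine ⟨⟨qm J (l ^ (n - (d + 1)) * f), _, hh, rfl⟩, ?_⟩
    rw [LinearMap.domRestrict_apply, hev', map_mul, map_pow, hφl, one_pow, one_mul]
    apply Subtype.ext
    rw [hev (d + 1) 0 (by omega) f hf, ← hfv]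
    simp
  have hdim : ∀ n, d + 1 ≤ n → Module.finrank k (gp J n) = r := by
    intro n hn
    refine le_antisymm ?_ ?_
    · induction n, hn using Nat.le_induction with
      | base => exact h1.le
      | succ n hn ih =>
        refine le_trans ?_ ih
        have h3 := gp_finrank_succ_le J l hs n (by omega)
        have h4 : (homogeneousSubmodule (Fin (N + 1)) k n).map (qm J ∘ₗ LinearMap.mulLeft k l) =
            (gp J n).map (LinearMap.mulLeft k (qm J l)) := by
          rw [← Submodule.map_comp]
          congr 1
        rw [h4] at h3
        exact (Submodule.finrank_mono h3).trans (Submodule.finrank_map_le _ _)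
    · rw [← h1]
      exact LinearMap.finrank_le_finrank_of_surjective (hevs n hn)
  refine ⟨hdim, ?_⟩
  rintro f n hn hf ⟨m, hm⟩
  have h3 : Function.Injective (ev.domRestrict (gp J n)) :=
    (LinearMap.injective_iff_surjective_of_finrank_eq_finrank ((hdim n hn).trans h1.symm)).2
      (hevs n hn)
  have h4 : ev (qm J f) = 0 := by
    have := hker _ hm
    rw [map_mul, map_pow, hφl, one_pow, mul_one] at this
    exact this
  have h5 : (⟨qm J f, f, hf, rfl⟩ : gp J n) = 0 := by
    apply h3
    rw [map_zero]; exact h4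
  exact (qm_eq_zero J f).1 (congrArg Subtype.val h5)

/-- Extension of a functional to an extension field. -/
noncomputable def extf {k : Type*} [Field k] (K : Type*) [Field K] [Algebra k K] {N : ℕ}
    (φ : MvPolynomial (Fin (N + 1)) k →ₗ[k] k) : MvPolynomial (Fin (N + 1)) K →ₗ[K] K :=
  (basisMonomials (Fin (N + 1)) K).constr K fun m => algebraMap k K (φ (monomial m 1))

theorem extf_map {k : Type*} [Field k] {K : Type*} [Field K] [Algebra k K] {N : ℕ}
    (φ : MvPolynomial (Fin (N + 1)) k →ₗ[k] k) (f : MvPolynomial (Fin (N + 1)) k) :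
    extf K φ (MvPolynomial.map (algebraMap k K) f) = algebraMap k K (φ f) := by
  induction f using MvPolynomial.induction_on' with
  | monomial m a =>
    have h1 : MvPolynomial.map (algebraMap k K) (monomial m a) =
        (algebraMap k K a) • basisMonomials (Fin (N + 1)) K m := by
      rw [coe_basisMonomials, map_monomial, smul_monomial]; simp
    have h2 : monomial m a = a • (monomial m 1 : MvPolynomial (Fin (N + 1)) k) := by
      rw [smul_monomial]; simp
    rw [h1, map_smul, extf, Module.Basis.constr_basis, h2, map_smul]
    simp
  | add p q hp hq => simp only [map_add, hp, hq]

theorem mapJ_le {k : Type*} [Field k] {K : Type*} [Field K] [Algebra k K] {N : ℕ}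
    (J : Ideal (MvPolynomial (Fin (N + 1)) k)) (f : MvPolynomial (Fin (N + 1)) K)
    (hf : f ∈ J.map (MvPolynomial.map (algebraMap k K))) :
    f ∈ Submodule.span K (MvPolynomial.map (algebraMap k K) '' (J : Set (MvPolynomial (Fin (N + 1)) k))) := by
  induction hf using Submodule.span_induction with
  | mem x hx => exact Submodule.subset_span hx
  | zero => exact Submodule.zero_mem _
  | add x y _ _ hx hy => exact Submodule.add_mem _ hx hy
  | smul a x hxx hx =>
    clear hxx
    induction hx using Submodule.span_induction with
    | zero => simp
    | add x y _ _ hx hy => rw [smul_add]; exact Submodule.add_mem _ hx hy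
    | smul c x _ hx => rw [smul_comm]; exact Submodule.smul_mem _ _ hx
    | mem x hx =>
      obtain ⟨j, hj, rfl⟩ := hx
      induction a using MvPolynomial.induction_on' with
      | add p q hp hq => rw [add_smul]; exact Submodule.add_mem _ hp hq
      | monomial m c =>
        have : monomial m c • MvPolynomial.map (algebraMap k K) j =
            c • MvPolynomial.map (algebraMap k K) (monomial m 1 * j) := by
          rw [map_mul, map_monomial, map_one, ← smul_mul_assoc, smul_monomial]
          simp
        rw [this]
        exact Submodule.smul_mem _ _ (Submodule.subset_span ⟨_, J.mul_mem_left _ hj, rfl⟩)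

theorem extf_mapJ {k : Type*} [Field k] {K : Type*} [Field K] [Algebra k K] {N : ℕ}
    (J : Ideal (MvPolynomial (Fin (N + 1)) k)) (φ : MvPolynomial (Fin (N + 1)) k →ₗ[k] k)
    (hφ : ∀ f ∈ J, φ f = 0) (f : MvPolynomial (Fin (N + 1)) K)
    (hf : f ∈ J.map (MvPolynomial.map (algebraMap k K))) : extf K φ f = 0 := by
  have h : Submodule.span K (MvPolynomial.map (algebraMap k K) '' (J : Set (MvPolynomial (Fin (N + 1)) k))) ≤
      LinearMap.ker (extf K φ) := by
    rw [Submodule.span_le]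
    rintro _ ⟨j, hj, rfl⟩
    rw [SetLike.mem_coe, LinearMap.mem_ker, extf_map, hφ j hj, map_zero]
  exact h (mapJ_le J f hf)

theorem mem_of_map_mem {k : Type*} [Field k] {K : Type*} [Field K] [Algebra k K] {N : ℕ}
    (J : Ideal (MvPolynomial (Fin (N + 1)) k)) (f : MvPolynomial (Fin (N + 1)) k)
    (hf : MvPolynomial.map (algebraMap k K) f ∈ J.map (MvPolynomial.map (algebraMap k K))) : f ∈ J := by
  by_contra h
  obtain ⟨φ, h1, h2⟩ := Submodule.exists_le_ker_of_notMem (p := J.restrictScalars k) (v := f) h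
  have := extf_mapJ J φ (fun g hg => h2 hg) _ hf
  rw [extf_map] at this
  exact h1 ((map_eq_zero_iff _ (algebraMap k K).injective).1 this)

theorem gp_map {k : Type*} [Field k] {K : Type*} [Field K] [Algebra k K] {N : ℕ}
    (J : Ideal (MvPolynomial (Fin (N + 1)) k)) (n : ℕ) :
    Module.finrank K (gp (J.map (MvPolynomial.map (algebraMap k K))) n) = Module.finrank k (gp J n) := by
  classical
  set JK := J.map (MvPolynomial.map (algebraMap k K)) with hJK
  let b := Module.finBasis k (gp J n)
  have hb : ∀ j, ∃ g ∈ homogeneousSubmodule (Fin (N + 1)) k n, qm J g = b j := fun j => (b j).2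
  choose g hg hgb using hb
  let w : Fin (Module.finrank k (gp J n)) → (MvPolynomial (Fin (N + 1)) K ⧸ JK) :=
    fun j => qm JK (MvPolynomial.map (algebraMap k K) (g j))
  have hbl : LinearIndependent k (fun j => (b j : MvPolynomial (Fin (N + 1)) k ⧸ J)) :=
    b.linearIndependent.map' (gp J n).subtype (by simp)
  -- functionals dual to the basis
  have hdual : ∀ j, ∃ φ : MvPolynomial (Fin (N + 1)) k →ₗ[k] k, (∀ f ∈ J, φ f = 0) ∧
      ∀ i, φ (g i) = if i = j then 1 else 0 := by
    intro j
    obtain ⟨ψ, hψ⟩ := LinearMap.exists_extend (b.coord j)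
    refine ⟨ψ ∘ₗ qm J, fun f hf => ?_, fun i => ?_⟩
    · rw [LinearMap.comp_apply, (qm_eq_zero J f).2 hf, map_zero]
    · rw [LinearMap.comp_apply, hgb]
      have := LinearMap.congr_fun hψ (b i)
      simp only [LinearMap.comp_apply, Submodule.subtype_apply] at this
      rw [this]
      simp [Finsupp.single_apply]
  choose φ hφJ hφg using hdual
  have hw : LinearIndependent K w := by
    rw [Fintype.linearIndependent_iff]
    intro c hc j
    have h1 : ∑ i, c i • MvPolynomial.map (algebraMap k K) (g i) ∈ JK := by
      rw [← qm_eq_zero, map_sum]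
      simp only [map_smul]
      exact hc
    have h2 := extf_mapJ J (φ j) (hφJ j) _ h1
    rw [map_sum] at h2
    simpa [extf_map, hφg] using h2
  have hspan : Submodule.span K (Set.range w) = gp JK n := by
    apply le_antisymm
    · rw [Submodule.span_le]
      rintro _ ⟨j, rfl⟩
      exact ⟨_, (hg j).map _, rfl⟩
    · rw [Submodule.map_le_iff_le_comap]
      intro f hf
      rw [f.as_sum]
      refine Submodule.sum_mem _ fun m hm => ?_
      have hmon : (monomial m (1 : k)).IsHomogeneous n := by
        apply isHomogeneous_monomial
        have := hf (mem_support_iff.1 hm)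
        rw [Finsupp.degree_eq_weight_one]; exact this
      have h1 : monomial m (coeff m f) =
          coeff m f • MvPolynomial.map (algebraMap k K) (monomial m 1) := by
        rw [map_monomial, smul_monomial]; simp
      rw [h1]
      refine Submodule.smul_mem _ _ ?_
      rw [Submodule.mem_comap]
      let v : gp J n := ⟨qm J (monomial m 1), _, hmon, rfl⟩
      have h2 : monomial m (1 : k) - ∑ j, b.repr v j • g j ∈ J := by
        rw [← qm_eq_zero, map_sub, map_sum, sub_eq_zero]
        have := congrArg (gp J n).subtype (b.sum_repr v)
        rw [map_sum] at this
        simp only [map_smul, hgb]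
        exact this.symm
      have h3 : qm JK (MvPolynomial.map (algebraMap k K) (monomial m 1)) =
          ∑ j, algebraMap k K (b.repr v j) • w j := by
        have h4 := Ideal.mem_map_of_mem (MvPolynomial.map (algebraMap k K)) h2
        rw [← hJK, ← qm_eq_zero, map_sub, map_sub, sub_eq_zero, map_sum, map_sum] at h4
        rw [h4]
        refine Finset.sum_congr rfl fun j _ => ?_
        have h5 : MvPolynomial.map (algebraMap k K) (b.repr v j • g j) =
            algebraMap k K (b.repr v j) • MvPolynomial.map (algebraMap k K) (g j) := by
          rw [smul_eq_C_mul, map_mul, map_C, ← smul_eq_C_mul]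
        rw [h5, map_smul]
      rw [h3]
      exact Submodule.sum_mem _ fun j _ =>
        Submodule.smul_mem _ _ (Submodule.subset_span ⟨j, rfl⟩)
  rw [← hspan, finrank_span_eq_card hw, Fintype.card_fin]

theorem main_aux {k : Type*} [Field k] {N r d : ℕ}
    (J : Ideal (MvPolynomial (Fin (N + 1)) k))
    (hgen : J = Ideal.span {f | f ∈ J ∧ ∃ n ≤ d + 1, MvPolynomial.IsHomogeneous f n})
    (hrd : r ≤ d + 1)
    (h1 : Module.finrank k (gp J (d + 1)) = r) (h2 : Module.finrank k (gp J (d + 2)) = r) :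
    (∀ n, d + 1 ≤ n → Module.finrank k (gp J n) = r) ∧
    (∀ f : MvPolynomial (Fin (N + 1)) k, ∀ n : ℕ, d + 1 ≤ n →
      MvPolynomial.IsHomogeneous f n →
      (∃ m : ℕ, ∀ g ∈ (irrel k N) ^ m, f * g ∈ J) → f ∈ J) := by
  let K := AlgebraicClosure k
  have hinf : Infinite K := IsAlgClosed.instInfinite
  set JK := J.map (MvPolynomial.map (algebraMap k K)) with hJK
  have hgenK : JK = Ideal.span {f | f ∈ JK ∧ ∃ n ≤ d + 1, MvPolynomial.IsHomogeneous f n} := by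
    apply le_antisymm
    · rw [hJK, Ideal.map_le_iff_le_comap, hgen, Ideal.span_le]
      rintro f ⟨hf, n, hn, hfn⟩
      rw [← hgen]
      exact Ideal.subset_span ⟨Ideal.mem_map_of_mem _ hf, n, hn, hfn.map _⟩
    · rw [Ideal.span_le]
      exact fun f hf => hf.1
  have h1K : Module.finrank K (gp JK (d + 1)) = r := by rw [hJK, gp_map, h1]
  have h2K : Module.finrank K (gp JK (d + 2)) = r := by rw [hJK, gp_map, h2]
  obtain ⟨s, hs⟩ := (green d (qm JK) (h1K.le.trans hrd)).exists
  obtain ⟨c1, c2⟩ := core JK (fun i => s ^ (i : ℕ)) (lin N s) rfl (lin_homog N s) hs hgenK h1K h2K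
  refine ⟨fun n hn => ?_, ?_⟩
  · rw [← c1 n hn, hJK, gp_map]
  · rintro f n hn hf ⟨m, hm⟩
    apply mem_of_map_mem (K := K)
    refine c2 _ n hn (hf.map _) ⟨m, ?_⟩
    have hl : lin N s ∈ (irrel k N).map (MvPolynomial.map (algebraMap k K)) := by
      refine Ideal.sum_mem _ fun i _ => ?_
      rw [smul_eq_C_mul]
      refine Ideal.mul_mem_left _ _ ?_
      rw [← map_X (algebraMap k K) i]
      exact Ideal.mem_map_of_mem _ (Ideal.subset_span ⟨i, rfl⟩)
    have hlm : lin N s ^ m ∈ ((irrel k N) ^ m).map (MvPolynomial.map (algebraMap k K)) := by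
      rw [Ideal.map_pow]; exact Ideal.pow_mem_pow hl m
    have hle : Ideal.span {f} * (irrel k N) ^ m ≤ J := by
      rw [Ideal.mul_le]
      intro a ha g hg
      obtain ⟨b, rfl⟩ := Ideal.mem_span_singleton'.1 ha
      rw [mul_assoc]
      exact J.mul_mem_left _ (hm g hg)
    have := Ideal.map_mono (f := MvPolynomial.map (algebraMap k K)) hle
    apply this
    rw [Ideal.map_mul]
    exact Ideal.mul_mem_mul (Ideal.mem_map_of_mem _ (Ideal.mem_span_singleton_self f)) hlm

end helpers

/-- **Gotzmann persistence step.** Let `k[α₀,…,α_N]` be the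
standard graded polynomial ring, `IX` a saturated homogeneous ideal generated
in degrees `≤ d` (the ideal of a projective scheme `X`), and `J ⊇ IX` a
homogeneous ideal generated in degrees `≤ d` (the lift to the polynomial ring
of a homogeneous ideal `I ⊆ S = k[α]/IX` generated in degrees `≤ d`).  Suppose
`d ≥ r` and `dim_k (S/I)_d = dim_k (S/I)_{d+1} = r` (here `(S/I)_n ≅
(k[α]/J)_n`).  Then `dim_k (S/I)_{d'} = r` for all `d' ≥ d` — i.e. the scheme
`Z(I) ⊆ X` cut out by `I` is finite of degree `r` — and `J` agrees with its
saturation in all degrees `≥ d`. -/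
theorem stmt_15 (k : Type*) [Field k] (N r d : ℕ)
    (IX J : Ideal (MvPolynomial (Fin (N + 1)) k))
    (hIXJ : IX ≤ J)
    (hIXhom : ∀ f ∈ IX, ∀ n : ℕ, homogeneousComponent n f ∈ IX)
    (hJhom : ∀ f ∈ J, ∀ n : ℕ, homogeneousComponent n f ∈ J)
    (hIXsat : ∀ f : MvPolynomial (Fin (N + 1)) k,
      (∃ n : ℕ, ∀ g ∈ (irrel k N) ^ n, f * g ∈ IX) → f ∈ IX)
    (hIXgen : IX = Ideal.span
      {f | f ∈ IX ∧ ∃ n ≤ d, MvPolynomial.IsHomogeneous f n})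
    (hJgen : J = Ideal.span
      {f | f ∈ J ∧ ∃ n ≤ d, MvPolynomial.IsHomogeneous f n})
    (hrd : r ≤ d)
    (h1 : hilb k N J d = r) (h2 : hilb k N J (d + 1) = r) :
    (∀ d' : ℕ, d ≤ d' → hilb k N J d' = r) ∧
    (∀ f : MvPolynomial (Fin (N + 1)) k, ∀ n : ℕ, d ≤ n →
      MvPolynomial.IsHomogeneous f n →
      (∃ m : ℕ, ∀ g ∈ (irrel k N) ^ m, f * g ∈ J) → f ∈ J) := by
  cases d with
  | zero =>
    obtain rfl : r = 0 := by omega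
    have h0 : (1 : MvPolynomial (Fin (N + 1)) k) ∈ J := by
      rw [hilb_eq] at h1
      have h3 := Submodule.finrank_eq_zero.1 h1
      have h4 : qm J 1 ∈ gp J 0 := ⟨1, isHomogeneous_one _ _, rfl⟩
      rw [h3, Submodule.mem_bot, qm_eq_zero] at h4
      exact h4
    have htop : ∀ f, f ∈ J := fun f => by
      have := J.mul_mem_left f h0
      rwa [mul_one] at this
    refine ⟨fun n _ => ?_, fun f _ _ _ _ => htop f⟩
    rw [hilb_eq, Submodule.finrank_eq_zero, eq_bot_iff]
    rintro _ ⟨f, _, rfl⟩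
    exact (qm_eq_zero J f).2 (htop f)
  | succ d =>
    rw [hilb_eq] at h1 h2
    obtain ⟨c1, c2⟩ := main_aux J hJgen hrd h1 h2
    exact ⟨fun n hn => by rw [hilb_eq]; exact c1 n hn, c2⟩
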